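/- Let E and B be compact Hausdorff spaces, let p : E → B be a continuous open surjective map, let γ be a flow on B and let γ' be a flow on E that is a lift of γ along p. If (A, A*) is an attractor-repellor decomposition of an isolated invariant set S of γ, then (p⁻¹(A), p⁻¹(A*)) is an attractor-repellor decomposition of the isolated invariant set p⁻¹(S) of γ'. -/

import Mathlib

/-- A flow on a topological space `X`. -/
def IsFlow {X : Type*} [TopologicalSpace X] (γ : ℝ × X → X) : Prop :=
  Continuous γ ∧ (∀ x, γ (0, x) = x) ∧ ∀ t s x, γ (t, γ (s, x)) = γ (t + s, x)

/-- A set `S` is invariant under the flow `γ`. -/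
def FlowInvariant {X : Type*} (γ : ℝ × X → X) (S : Set X) : Prop :=
  ∀ x ∈ S, ∀ t : ℝ, γ (t, x) ∈ S

/-- The maximal invariant subset `I(M)` of `M`. -/
def MaxInvariant {X : Type*} (γ : ℝ × X → X) (M : Set X) : Set X :=
  {x ∈ M | ∀ t : ℝ, γ (t, x) ∈ M}

/-- `M` is an isolating neighborhood of `S` for the flow `γ`. -/
def IsIsolatingNbhd {X : Type*} [TopologicalSpace X] (γ : ℝ × X → X) (S M : Set X) : Prop :=
  IsCompact M ∧ S ⊆ interior M ∧ S = MaxInvariant γ M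

/-- `S` is an isolated invariant set of the flow `γ`. -/
def IsIsolatedInvSet {X : Type*} [TopologicalSpace X] (γ : ℝ × X → X) (S : Set X) : Prop :=
  FlowInvariant γ S ∧ ∃ M, IsIsolatingNbhd γ S M

/-- The reverse flow `-γ`, given by `(-γ)(t, x) = γ(-t, x)`. -/
def RevFlow {X : Type*} (γ : ℝ × X → X) : ℝ × X → X :=
  fun q => γ (-q.1, q.2)

/-- The ω-limit set of `x` under the flow `γ`. -/
def OmegaSet {X : Type*} [TopologicalSpace X] (γ : ℝ × X → X) (x : X) : Set X :=
  ⋂ T : ℝ, closure ((fun t => γ (t, x)) '' Set.Ici T)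

/-- `(A, A')` is an attractor-repellor decomposition of the isolated invariant set `S`
of the flow `γ`. -/
def IsAttractorRepellor {X : Type*} [TopologicalSpace X] (γ : ℝ × X → X)
    (S A A' : Set X) : Prop :=
  IsIsolatedInvSet γ A ∧ IsIsolatedInvSet γ A' ∧ Disjoint A A' ∧ A ⊆ S ∧ A' ⊆ S ∧
  ∀ x ∈ S \ (A ∪ A'), OmegaSet γ x ⊆ A ∧ OmegaSet (RevFlow γ) x ⊆ A'

theorem FlowInvariant.preimage {E B : Type*} {p : E → B} {γ : ℝ × B → B} {γ' : ℝ × E → E}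
    (hlift : ∀ (t : ℝ) (x : E), p (γ' (t, x)) = γ (t, p x)) {S : Set B}
    (hS : FlowInvariant γ S) : FlowInvariant γ' (p ⁻¹' S) := fun x hx t => by
  simpa only [Set.mem_preimage, hlift] using hS (p x) hx t

theorem MaxInvariant.preimage {E B : Type*} {p : E → B} {γ : ℝ × B → B} {γ' : ℝ × E → E}
    (hlift : ∀ (t : ℝ) (x : E), p (γ' (t, x)) = γ (t, p x)) (M : Set B) :
    p ⁻¹' MaxInvariant γ M = MaxInvariant γ' (p ⁻¹' M) := by
  ext x
  simp [MaxInvariant, hlift]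

theorem IsIsolatedInvSet.preimage {E B : Type*} [TopologicalSpace E] [TopologicalSpace B]
    [CompactSpace E] [T2Space B] {p : E → B} (hp : Continuous p)
    {γ : ℝ × B → B} {γ' : ℝ × E → E}
    (hlift : ∀ (t : ℝ) (x : E), p (γ' (t, x)) = γ (t, p x)) {S : Set B}
    (hS : IsIsolatedInvSet γ S) : IsIsolatedInvSet γ' (p ⁻¹' S) := by
  obtain ⟨hinv, M, hM, hSM, hmax⟩ := hS
  refine ⟨hinv.preimage hlift, p ⁻¹' M, (hM.isClosed.preimage hp).isCompact,
    (Set.preimage_mono hSM).trans (preimage_interior_subset_interior_preimage hp), ?_⟩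
  rw [← MaxInvariant.preimage hlift M, ← hmax]

theorem OmegaSet.mapsTo {E B : Type*} [TopologicalSpace E] [TopologicalSpace B]
    {p : E → B} (hp : Continuous p) {γ : ℝ × B → B} {γ' : ℝ × E → E}
    (hlift : ∀ (t : ℝ) (x : E), p (γ' (t, x)) = γ (t, p x)) (x : E) :
    Set.MapsTo p (OmegaSet γ' x) (OmegaSet γ (p x)) := by
  intro y hy
  refine Set.mem_iInter.2 fun T => map_mem_closure hp (Set.mem_iInter.1 hy T) ?_
  rintro _ ⟨t, ht, rfl⟩
  exact ⟨t, ht, (hlift t x).symm⟩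

theorem preimage_attractorRepellor
    {E B : Type*} [TopologicalSpace E] [TopologicalSpace B]
    [CompactSpace E] [T2Space E] [CompactSpace B] [T2Space B]
    (p : E → B) (hp : Continuous p) (hopen : IsOpenMap p) (hsurj : Function.Surjective p)
    (γ : ℝ × B → B) (hγ : IsFlow γ)
    (γ' : ℝ × E → E) (hγ' : IsFlow γ')
    (hlift : ∀ (t : ℝ) (x : E), p (γ' (t, x)) = γ (t, p x))
    (S A A' : Set B) (hS : IsIsolatedInvSet γ S)
    (hAR : IsAttractorRepellor γ S A A') :
    IsIsolatedInvSet γ' (p ⁻¹' S) ∧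
      IsAttractorRepellor γ' (p ⁻¹' S) (p ⁻¹' A) (p ⁻¹' A') := by
  obtain ⟨hA, hA', hdisj, hAS, hAS', hω⟩ := hAR
  refine ⟨hS.preimage hp hlift, hA.preimage hp hlift, hA'.preimage hp hlift,
    hdisj.preimage p, Set.preimage_mono hAS, Set.preimage_mono hAS', fun x hx => ?_⟩
  obtain ⟨h₁, h₂⟩ := hω (p x) hx
  exact ⟨fun y hy => h₁ (OmegaSet.mapsTo hp hlift x hy),
    fun y hy => h₂ (OmegaSet.mapsTo (γ := RevFlow γ) (γ' := RevFlow γ') hp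
      (fun t z => hlift (-t) z) x hy)⟩
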